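/- arXiv:math/0401438 — 2 statements merged into one kernel-verified Lean document; each statement's English description precedes it below -/
import Mathlib

section
/- Let m, n ≥ 1, let ψ : ℝ₊ → V, and for q ∈ 𝔽[X]^m with q ≠ 0 define B_q = {A ∈ I^{mn} : there exists p ∈ 𝔽[X]^n with ‖qA − p‖_∞ < ψ(‖q‖_∞)}. If q, q' ∈ 𝔽[X]^m are linearly independent over L, then μ(B_q ∩ B_{q'}) = μ(B_q) · μ(B_{q'}). -/
open MeasureTheory Filter Asymptotics
open scoped Classical

/-- The absolute value on `L`, the field of formal Laurent series in `X⁻¹` over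
the finite field `F` with `k = Fintype.card F` elements (here realised as
`LaurentSeries F` in the variable `t = X⁻¹`): `‖x‖ = k ^ (-order x)`, `‖0‖ = 0`. -/
noncomputable def lnorm (F : Type*) [Field F] [Fintype F] (x : LaurentSeries F) : ℝ :=
  if x = 0 then 0 else (Fintype.card F : ℝ) ^ (-x.order)

/-- The embedding of the polynomial ring `F[X]` into `L`, sending `X` to the
Laurent series with a single term of order `-1` (the element of norm `k`). -/
noncomputable def polyToL (F : Type*) [Field F] [Fintype F] (p : Polynomial F) :
    LaurentSeries F :=
  Polynomial.aeval (HahnSeries.single (-1 : ℤ) (1 : F)) p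

/-- Sup norm `‖·‖_∞` of a vector over `L`. -/
noncomputable def vnorm (F : Type*) [Field F] [Fintype F] {ι : Type*}
    (v : ι → LaurentSeries F) : ℝ :=
  ⨆ i, lnorm F (v i)

/-- Sup norm `‖·‖_∞` of a vector of polynomials, viewed inside `L`. -/
noncomputable def pvnorm (F : Type*) [Field F] [Fintype F] {ι : Type*}
    (q : ι → Polynomial F) : ℝ :=
  vnorm F fun i => polyToL F (q i)

/-- The row vector `q A ∈ L^n`, for `q ∈ F[X]^m` and an `m × n` matrix `A` over `L`. -/
noncomputable def rowMul (F : Type*) [Field F] [Fintype F] {m n : ℕ}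
    (q : Fin m → Polynomial F) (A : Fin m → Fin n → LaurentSeries F) :
    Fin n → LaurentSeries F :=
  fun j => ∑ i, polyToL F (q i) * A i j

noncomputable instance (F : Type*) [Field F] [Fintype F] :
    MeasurableSpace (LaurentSeries F) := borel _

/-- The unit ball `I^{mn}` in the space of `m × n` matrices over `L`. -/
def unitBallM (F : Type*) [Field F] [Fintype F] (m n : ℕ) :
    Set (Fin m → Fin n → LaurentSeries F) :=
  {A | ∀ i j, lnorm F (A i j) < 1}

/-- The set `B_q ⊆ I^{mn}` of matrices `A` in the unit ball for which some
`p ∈ F[X]^n` satisfies `‖q A - p‖_∞ < ψ(‖q‖_∞)`. -/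
def approxSet (F : Type*) [Field F] [Fintype F] {m n : ℕ} (ψ : ℝ → ℝ)
    (q : Fin m → Polynomial F) : Set (Fin m → Fin n → LaurentSeries F) :=
  {A | (∀ i j, lnorm F (A i j) < 1) ∧
    ∃ p : Fin n → Polynomial F,
      vnorm F (fun j => rowMul F q A j - polyToL F (p j)) < ψ (pvnorm F q)}

section MeasureOfSubgroups

variable {G : Type*} [AddCommGroup G] [MeasurableSpace G] [MeasurableAdd₂ G] [MeasurableNeg G]

/-- If `K = H + H'` has measure one for a translation-invariant measure, then the subgroups
`H` and `H'` are independent: compute `(μ × μ) {(y, x) ∈ K × H | x - y ∈ H'}` in both orders. -/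
theorem measure_addSubgroup_inter_of_sup_eq (μ : Measure G) [μ.IsAddLeftInvariant]
    {H H' K : AddSubgroup G} (hH : MeasurableSet (H : Set G)) (hH' : MeasurableSet (H' : Set G))
    (hK : MeasurableSet (K : Set G)) (hsup : H ⊔ H' = K) (hμ : μ (K : Set G) = 1) :
    μ ((H : Set G) ∩ H') = μ (H : Set G) * μ (H' : Set G) := by
  have hHK : H ≤ K := hsup ▸ le_sup_left
  have hH'K : H' ≤ K := hsup ▸ le_sup_right
  have : IsFiniteMeasure (μ.restrict (K : Set G)) := ⟨by simp [hμ]⟩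
  set ν := μ.restrict (K : Set G) with hν
  let S : Set (G × G) := {z | z.2 ∈ H ∧ z.2 - z.1 ∈ H'}
  have hS : MeasurableSet S :=
    (measurable_snd hH).inter ((measurable_snd.sub measurable_fst) hH')
  have hleft : (ν.prod ν) S = μ ((H : Set G) ∩ H') := by
    rw [Measure.prod_apply hS]
    have hslice : ∀ y ∈ (K : Set G), ν (Prod.mk y ⁻¹' S) = μ ((H : Set G) ∩ H') := by
      intro y hy
      obtain ⟨h, hh, h', hh', rfl⟩ := AddSubgroup.mem_sup.1 (hsup ▸ hy : y ∈ H ⊔ H')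
      rw [hν, Measure.restrict_apply (measurable_prodMk_left hS), ← measure_preimage_add μ h]
      congr 1
      ext x
      have hx : h + x - (h + h') = x + -h' := by abel
      simp only [S, Set.mem_preimage, Set.mem_inter_iff, Set.mem_ofPred_eq, SetLike.mem_coe, hx,
        H.add_mem_cancel_left hh, H'.add_mem_cancel_right (H'.neg_mem hh')]
      exact ⟨fun hx => hx.1, fun hx => ⟨hx, K.add_mem (hHK hh) (hHK hx.1)⟩⟩
    rw [hν, setLIntegral_congr_fun hK hslice, setLIntegral_const, hμ, mul_one]
  have hright : (ν.prod ν) S = μ (H : Set G) * μ (H' : Set G) := by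
    rw [Measure.prod_apply_symm hS]
    have hslice : ∀ x, ν ((fun y => (y, x)) ⁻¹' S) =
        (H : Set G).indicator (fun _ => μ (H' : Set G)) x := by
      intro x
      by_cases hx : x ∈ H
      · rw [Set.indicator_of_mem (show x ∈ (H : Set G) from hx), hν,
          Measure.restrict_apply (measurable_prodMk_right hS), ← measure_preimage_add μ (-x)
          (H' : Set G)]
        congr 1
        ext y
        have hy : x - y = -(-x + y) := by abel
        simp only [S, Set.mem_preimage, Set.mem_inter_iff, Set.mem_ofPred_eq, SetLike.mem_coe, hx,
          hy, neg_mem_iff, true_and]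
        exact ⟨fun h => h.1, fun h => ⟨h, by simpa using K.add_mem (hHK hx) (hH'K h)⟩⟩
      · rw [Set.indicator_of_notMem (show x ∉ (H : Set G) from hx)]
        have : (fun y => (y, x)) ⁻¹' S = ∅ := by
          ext y
          simp [S, hx]
        rw [this, measure_empty]
    rw [lintegral_congr hslice, lintegral_indicator_const hH, hν, Measure.restrict_apply hH,
      Set.inter_eq_left.2 hHK, mul_comm]
  rw [← hleft, hright]

end MeasureOfSubgroups

section LaurentSeriesTopology

variable (F : Type*) [Field F]

/-- The subgroup of Laurent series whose coefficients of index at most `j` vanish. -/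
def coeffBall (j : ℤ) : AddSubgroup (LaurentSeries F) where
  carrier := {x | ∀ i ≤ j, x.coeff i = 0}
  zero_mem' := by simp
  add_mem' := by
    intro a b ha hb i hi
    simp [ha i hi, hb i hi]
  neg_mem' := by
    intro a ha i hi
    simp [ha i hi]

theorem coeffBall_eq_valuation_le (j : ℤ) :
    (coeffBall F j : Set (LaurentSeries F)) =
      {x | (Valued.v x : WithZero (Multiplicative ℤ)) ≤ WithZero.exp (-(j + 1))} := by
  ext x
  simp only [Set.mem_ofPred_eq, LaurentSeries.valuation_le_iff_coeff_lt_eq_zero, Int.lt_add_one_iff]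
  rfl

theorem hasBasis_nhds_zero_coeffBall :
    (nhds (0 : LaurentSeries F)).HasBasis (fun _ : ℤ => True)
      fun j => (coeffBall F j : Set (LaurentSeries F)) := by
  refine ⟨fun s => ?_⟩
  rw [Valued.mem_nhds_zero]
  constructor
  · rintro ⟨γ, hγ⟩
    obtain ⟨d, hd⟩ : ∃ d : ℤ, WithZero.exp d =
        MonoidWithZeroHom.ValueGroup₀.embedding γ.1 := by
      refine ⟨WithZero.log (MonoidWithZeroHom.ValueGroup₀.embedding γ.1), WithZero.exp_log ?_⟩
      simp
    refine ⟨-d, trivial, fun x hx => hγ ?_⟩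
    rw [coeffBall_eq_valuation_le] at hx
    rw [Set.mem_ofPred_eq, Valuation.restrict_lt_iff_lt_embedding, ← hd]
    refine lt_of_le_of_lt hx ?_
    rw [WithZero.exp_lt_exp]
    omega
  · rintro ⟨j, -, hj⟩
    obtain ⟨y, hy⟩ := LaurentSeries.valuation_surjective F (WithZero.exp (-(j + 1)))
    have hy0 : (Valued.v : Valuation (LaurentSeries F) _).restrict y ≠ 0 := by
      rw [Ne, Valuation.restrict_eq_zero_iff, hy]
      simp
    refine ⟨Units.mk0 _ hy0, fun x hx => hj ?_⟩
    rw [coeffBall_eq_valuation_le, Set.mem_ofPred_eq, ← hy]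
    exact ((Valuation.restrict_lt_iff _).1 hx).le

theorem isOpen_of_coeffBall_le {H : AddSubgroup (LaurentSeries F)} {j : ℤ}
    (h : coeffBall F j ≤ H) : IsOpen (H : Set (LaurentSeries F)) :=
  H.isOpen_of_mem_nhds (g := 0)
    (Filter.mem_of_superset ((hasBasis_nhds_zero_coeffBall F).mem_of_mem trivial) h)

/-- The unit ball of matrices as an additive subgroup. -/
def unitBallSubgroup (m n : ℕ) : AddSubgroup (Fin m → Fin n → LaurentSeries F) :=
  AddSubgroup.pi Set.univ fun _ => AddSubgroup.pi Set.univ fun _ => coeffBall F 0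

theorem mem_unitBallSubgroup {m n : ℕ} {A : Fin m → Fin n → LaurentSeries F} :
    A ∈ unitBallSubgroup F m n ↔ ∀ i c, A i c ∈ coeffBall F 0 := by
  simp [unitBallSubgroup, AddSubgroup.mem_pi]

theorem isOpen_unitBallSubgroup {m n : ℕ} :
    IsOpen (unitBallSubgroup F m n : Set (Fin m → Fin n → LaurentSeries F)) :=
  isOpen_set_pi Set.finite_univ fun _ _ => isOpen_set_pi Set.finite_univ fun _ _ =>
    isOpen_of_coeffBall_le F le_rfl

theorem secondCountableTopology_laurentSeries [Countable F] :
    SecondCountableTopology (LaurentSeries F) := by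
  have hcg : (nhds (0 : LaurentSeries F)).IsCountablyGenerated :=
    (hasBasis_nhds_zero_coeffBall F).isCountablyGenerated
  have : (uniformity (LaurentSeries F)).IsCountablyGenerated :=
    IsUniformAddGroup.uniformity_countably_generated
  have hpoly : Countable (Polynomial F) := by
    rw [← Cardinal.mk_le_aleph0_iff]
    exact Polynomial.cardinalMk_le_max.trans (max_le Cardinal.mk_le_aleph0 le_rfl)
  have hrat : Countable (RatFunc F) := by
    rw [← Cardinal.mk_le_aleph0_iff]
    exact (IsFractionRing.cardinalMk (Polynomial F) (RatFunc F)).trans_le Cardinal.mk_le_aleph0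
  have : TopologicalSpace.SeparableSpace (LaurentSeries F) :=
    ⟨_, Set.countable_range _, LaurentSeries.coe_range_dense⟩
  exact UniformSpace.secondCountable_of_separable _

end LaurentSeriesTopology

/-- Two linearly independent vectors can be separated by a coordinate vector. -/
theorem exists_sum_mul_eq_zero_and_eq_one {K ι : Type*} [Field K] [Fintype ι] {v w : ι → K}
    (h : LinearIndependent K ![v, w]) :
    ∃ b : ι → K, ∑ i, v i * b i = 0 ∧ ∑ i, w i * b i = 1 := by
  have hw : w ∉ Submodule.span K {v} := by
    intro hw
    obtain ⟨a, ha⟩ := Submodule.mem_span_singleton.1 hw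
    have := LinearIndependent.pair_iff.1 h a (-1) (by simp [ha])
    simp at this
  obtain ⟨f, hfw, hf⟩ := Submodule.exists_le_ker_of_notMem hw
  have hfv : f v = 0 := hf (Submodule.mem_span_singleton_self v)
  have hsum : ∀ u : ι → K,
      ∑ i, u i * ((f w)⁻¹ * f fun l => if i = l then 1 else 0) = (f w)⁻¹ * f u := by
    intro u
    rw [LinearMap.pi_apply_eq_sum_univ f u, Finset.mul_sum]
    exact Finset.sum_congr rfl fun i _ => mul_left_comm _ _ _
  exact ⟨_, by rw [hsum, hfv, mul_zero], by rw [hsum, inv_mul_cancel₀ hfw]⟩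

section ApproxSet

variable (F : Type*) [Field F] [Fintype F]

theorem lnorm_lt_zpow_iff (x : LaurentSeries F) (j : ℤ) :
    lnorm F x < (Fintype.card F : ℝ) ^ (-j) ↔ x ∈ coeffBall F j := by
  have hcard : (1 : ℝ) < Fintype.card F := by exact_mod_cast Fintype.one_lt_card
  by_cases hx : x = 0
  · simp only [lnorm, hx, if_true, zero_mem, iff_true]
    positivity
  rw [lnorm, if_neg hx, zpow_lt_zpow_iff_right₀ hcard, neg_lt_neg_iff]
  constructor
  · exact fun h i hi => HahnSeries.coeff_eq_zero_of_lt_order (hi.trans_lt h)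
  · intro h
    by_contra! hle
    exact hx (HahnSeries.coeff_order_eq_zero.1 (h _ hle))

theorem lnorm_lt_one_iff (x : LaurentSeries F) : lnorm F x < 1 ↔ x ∈ coeffBall F 0 := by
  simpa using lnorm_lt_zpow_iff F x 0

theorem lnorm_pos {x : LaurentSeries F} (hx : x ≠ 0) : 0 < lnorm F x := by
  have : (0 : ℝ) < Fintype.card F := by exact_mod_cast Fintype.card_pos
  rw [lnorm, if_neg hx]
  positivity

theorem vnorm_lt_iff {ι : Type*} [Finite ι] (v : ι → LaurentSeries F) {r : ℝ} (hr : 0 < r) :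
    vnorm F v < r ↔ ∀ i, lnorm F (v i) < r := by
  constructor
  · exact fun h i => (le_ciSup (Set.finite_range fun i => lnorm F (v i)).bddAbove i).trans_lt h
  · intro h
    rcases isEmpty_or_nonempty ι with hι | hι
    · simpa [vnorm] using hr
    · obtain ⟨i, hi⟩ := exists_eq_ciSup_of_finite (f := fun i => lnorm F (v i))
      rw [vnorm, ← hi]
      exact h i

theorem vnorm_pos {ι : Type*} [Finite ι] {v : ι → LaurentSeries F} (hv : v ≠ 0) :
    0 < vnorm F v := by
  obtain ⟨i, hi⟩ := Function.ne_iff.1 hv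
  exact (lnorm_pos F hi).trans_le
    (le_ciSup (Set.finite_range fun i => lnorm F (v i)).bddAbove i)

/-- The subring of polynomials in `X`, inside the Laurent series in `X⁻¹`. -/
noncomputable def polyRange : Subring (LaurentSeries F) :=
  (Polynomial.aeval (R := F) (HahnSeries.single (-1 : ℤ) (1 : F))).toRingHom.range

theorem polyToL_monomial (i : ℕ) (a : F) :
    polyToL F (Polynomial.monomial i a) = HahnSeries.single (-(i : ℤ)) a := by
  rw [polyToL, Polynomial.aeval_monomial, HahnSeries.single_pow, LaurentSeries.algebraMap_apply,
    HahnSeries.C_apply, HahnSeries.single_mul_single]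
  simp

theorem exists_sub_mem_coeffBall (x : LaurentSeries F) :
    ∃ y ∈ polyRange F, x - y ∈ coeffBall F 0 := by
  let N : ℕ := (-x.order).toNat + 1
  refine ⟨∑ i ∈ Finset.range N, HahnSeries.single (-(i : ℤ)) (x.coeff (-i)),
    sum_mem fun i _ => ⟨_, polyToL_monomial F i _⟩, fun i hi => ?_⟩
  obtain ⟨l, rfl⟩ : ∃ l : ℕ, i = -l := ⟨(-i).toNat, by omega⟩
  rw [HahnSeries.coeff_sub, HahnSeries.coeff_sum]
  simp only [HahnSeries.coeff_single, neg_inj, Nat.cast_inj, Finset.sum_ite_eq, Finset.mem_range]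
  split_ifs with hl
  · exact sub_self _
  · rw [sub_zero]
    exact HahnSeries.coeff_eq_zero_of_lt_order (by omega)

variable {m n : ℕ}

theorem rowMul_add (q : Fin m → Polynomial F) (A B : Fin m → Fin n → LaurentSeries F) :
    rowMul F q (A + B) = rowMul F q A + rowMul F q B := by
  ext1 c
  simp [rowMul, mul_add, Finset.sum_add_distrib]

/-- The map `A ↦ q A` as a homomorphism of additive groups. -/
noncomputable def rowMulHom (q : Fin m → Polynomial F) :
    (Fin m → Fin n → LaurentSeries F) →+ (Fin n → LaurentSeries F) :=
  AddMonoidHom.mk' (rowMul F q) (rowMul_add F q)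

theorem continuous_rowMulHom (q : Fin m → Polynomial F) :
    Continuous (rowMulHom F (n := n) q) := by
  change Continuous fun A => rowMul F q A
  unfold rowMul
  fun_prop

theorem rowMulHom_mem_polyRange (q : Fin m → Polynomial F)
    {A : Fin m → Fin n → LaurentSeries F} (hA : ∀ i c, A i c ∈ polyRange F) (c : Fin n) :
    rowMulHom F q A c ∈ polyRange F := by
  change ∑ i, polyToL F (q i) * A i c ∈ polyRange F
  exact (polyRange F).sum_mem fun i _ => (polyRange F).mul_mem ⟨q i, rfl⟩ (hA i c)

theorem coe_unitBallSubgroup :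
    (unitBallSubgroup F m n : Set (Fin m → Fin n → LaurentSeries F)) = unitBallM F m n := by
  ext A
  simp [mem_unitBallSubgroup, unitBallM, lnorm_lt_one_iff]

/-- The matrices `A` in the unit ball such that every entry of `q A` lies within distance
less than `k ^ (-j)` of a polynomial. -/
noncomputable def approxSubgroup (q : Fin m → Polynomial F) (j : ℤ) :
    AddSubgroup (Fin m → Fin n → LaurentSeries F) :=
  unitBallSubgroup F m n ⊓ (AddSubgroup.pi Set.univ fun _ : Fin n =>
    (polyRange F).toAddSubgroup ⊔ coeffBall F j).comap (rowMulHom F q)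

theorem mem_approxSubgroup {q : Fin m → Polynomial F} {j : ℤ}
    {A : Fin m → Fin n → LaurentSeries F} :
    A ∈ approxSubgroup F q j ↔ A ∈ unitBallSubgroup F m n ∧
      ∀ c, rowMulHom F q A c ∈ (polyRange F).toAddSubgroup ⊔ coeffBall F j := by
  simp [approxSubgroup, AddSubgroup.mem_pi]

theorem mem_approxSubgroup_of_mem_polyRange {q : Fin m → Polynomial F} (j : ℤ)
    {A : Fin m → Fin n → LaurentSeries F} (hA : A ∈ unitBallSubgroup F m n)
    (h : ∀ c, rowMulHom F q A c ∈ polyRange F) : A ∈ approxSubgroup F q j :=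
  (mem_approxSubgroup F).2 ⟨hA, fun c => AddSubgroup.mem_sup_left (h c)⟩

theorem coe_approxSubgroup {ψ : ℝ → ℝ} {q : Fin m → Polynomial F} {j : ℤ}
    (hψ : ψ (pvnorm F q) = (Fintype.card F : ℝ) ^ (-j)) :
    (approxSubgroup F (n := n) q j : Set (Fin m → Fin n → LaurentSeries F)) = approxSet F ψ q := by
  have hpos : (0 : ℝ) < (Fintype.card F : ℝ) ^ (-j) := by
    have : (0 : ℝ) < Fintype.card F := by exact_mod_cast Fintype.card_pos
    positivity
  ext A
  simp only [SetLike.mem_coe, mem_approxSubgroup, mem_unitBallSubgroup, approxSet,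
    Set.mem_ofPred_eq, lnorm_lt_one_iff, hψ, vnorm_lt_iff F _ hpos, lnorm_lt_zpow_iff]
  refine and_congr_right fun _ => ?_
  rw [← Classical.skolem (p := fun c p => rowMul F q A c - polyToL F p ∈ coeffBall F j)]
  refine forall_congr' fun c => ?_
  rw [AddSubgroup.mem_sup]
  constructor
  · rintro ⟨y, ⟨p, rfl⟩, z, hz, h⟩
    refine ⟨p, ?_⟩
    rw [eq_sub_iff_add_eq'.2 h] at hz
    exact hz
  · rintro ⟨p, hp⟩
    exact ⟨polyToL F p, ⟨p, rfl⟩, _, hp, add_sub_cancel _ _⟩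

theorem isOpen_approxSubgroup (q : Fin m → Polynomial F) (j : ℤ) :
    IsOpen (approxSubgroup F (n := n) q j : Set (Fin m → Fin n → LaurentSeries F)) :=
  (isOpen_unitBallSubgroup F).inter <| (isOpen_set_pi Set.finite_univ fun _ _ =>
    isOpen_of_coeffBall_le F le_sup_right).preimage (continuous_rowMulHom F q)

theorem approxSubgroup_sup_approxSubgroup {q q' : Fin m → Polynomial F}
    (hind : LinearIndependent (LaurentSeries F)
      ![fun i => polyToL F (q i), fun i => polyToL F (q' i)]) (j j' : ℤ) :
    approxSubgroup F q j ⊔ approxSubgroup F q' j' = unitBallSubgroup F m n := by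
  refine le_antisymm (sup_le inf_le_left inf_le_left) fun A hA => ?_
  obtain ⟨b, hb, hb'⟩ := exists_sum_mul_eq_zero_and_eq_one hind
  let B : Fin m → Fin n → LaurentSeries F := fun i c => b i * rowMulHom F q' A c
  have hqB : rowMulHom F q B = 0 := by
    ext1 c
    change ∑ i, polyToL F (q i) * (b i * rowMulHom F q' A c) = 0
    simp_rw [← mul_assoc]
    rw [← Finset.sum_mul, hb, zero_mul]
  have hq'B : rowMulHom F q' B = rowMulHom F q' A := by
    ext1 c
    change ∑ i, polyToL F (q' i) * (b i * rowMulHom F q' A c) = _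
    simp_rw [← mul_assoc]
    rw [← Finset.sum_mul, hb', one_mul]
  choose P hP hBP using fun i c => exists_sub_mem_coeffBall F (B i c)
  have hC : B - P ∈ unitBallSubgroup F m n := (mem_unitBallSubgroup F).2 hBP
  refine AddSubgroup.mem_sup.2 ⟨B - P, ?_, A - (B - P), ?_, add_sub_cancel _ _⟩
  · refine mem_approxSubgroup_of_mem_polyRange F j hC fun c => ?_
    rw [map_sub, hqB, zero_sub]
    exact neg_mem (rowMulHom_mem_polyRange F q hP c)
  · refine mem_approxSubgroup_of_mem_polyRange F j' (sub_mem hA hC) fun c => ?_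
    rw [map_sub, map_sub, hq'B, sub_sub_cancel]
    exact rowMulHom_mem_polyRange F q' hP c

end ApproxSet

/-- **Proposition 2 (pairwise independence).**  For `m, n ≥ 1`, `ψ : ℝ₊ → V`
and `q, q' ∈ F[X]^m` linearly independent over `L`, the sets `B_q` and
`B_{q'}` are independent: `μ(B_q ∩ B_{q'}) = μ(B_q) · μ(B_{q'})`. -/
theorem measure_approxSet_inter
    {F : Type*} [Field F] [Fintype F]
    (m n : ℕ) (hm : 1 ≤ m) (hn : 1 ≤ n)
    (ψ : ℝ → ℝ)
    (hψV : ∀ x > (0 : ℝ), ∃ j : ℕ, ψ x = (Fintype.card F : ℝ) ^ (-(j : ℤ)))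
    (μ : Measure (Fin m → Fin n → LaurentSeries F)) [μ.IsAddHaarMeasure]
    (hμ : μ (unitBallM F m n) = 1)
    (q q' : Fin m → Polynomial F)
    (hind : LinearIndependent (LaurentSeries F)
      ![fun i => polyToL F (q i), fun i => polyToL F (q' i)]) :
    μ (approxSet F (n := n) ψ q ∩ approxSet F (n := n) ψ q') =
      μ (approxSet F (n := n) ψ q) * μ (approxSet F (n := n) ψ q') := by
  have := secondCountableTopology_laurentSeries F
  have : BorelSpace (LaurentSeries F) := ⟨rfl⟩
  have hq : 0 < pvnorm F q := vnorm_pos F (hind.ne_zero 0)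
  have hq' : 0 < pvnorm F q' := vnorm_pos F (hind.ne_zero 1)
  obtain ⟨j, hj⟩ := hψV _ hq
  obtain ⟨j', hj'⟩ := hψV _ hq'
  rw [← coe_approxSubgroup F hj, ← coe_approxSubgroup F hj']
  exact measure_addSubgroup_inter_of_sup_eq μ (isOpen_approxSubgroup F q j).measurableSet
    (isOpen_approxSubgroup F q' j').measurableSet (isOpen_unitBallSubgroup F).measurableSet
    (approxSubgroup_sup_approxSubgroup F hind j j') (by rw [coe_unitBallSubgroup, hμ])
end

section
/- Let q = (q₁, q₂) and q' = (q₁', q₂') be vectors in 𝔽[X]² that are linearly independent over L. Then the number of column vectors A = (a₁, a₂) ∈ L² with max(‖a₁‖, ‖a₂‖) < 1 such that both q₁a₁ + q₂a₂ ∈ 𝔽[X] and q₁'a₁ + q₂'a₂ ∈ 𝔽[X] equals ‖q₁q₂' − q₂q₁'‖, the absolute value of the determinant of the matrix with rows q and q'. -/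
open MeasureTheory Filter Asymptotics
open scoped Classical

open Polynomial

section

variable {F : Type*} [Field F] [Fintype F]

theorem polyToL_add (p r : F[X]) : polyToL F (p + r) = polyToL F p + polyToL F r := by
  simp [polyToL]

theorem polyToL_sub (p r : F[X]) : polyToL F (p - r) = polyToL F p - polyToL F r := by
  simp [polyToL]

theorem polyToL_mul (p r : F[X]) : polyToL F (p * r) = polyToL F p * polyToL F r := by
  simp [polyToL]

theorem polyToL_zero : polyToL F 0 = 0 := by
  simp [polyToL]

theorem polyToL_one : polyToL F 1 = 1 := by
  simp [polyToL]

theorem polyToL_monomial_s7 (n : ℕ) (c : F) :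
    polyToL F (monomial n c) = HahnSeries.single (-n : ℤ) c := by
  rw [polyToL, aeval_monomial, HahnSeries.single_pow, HahnSeries.algebraMap_apply']
  simp

theorem coeff_polyToL_neg (p : F[X]) (n : ℕ) : (polyToL F p).coeff (-n : ℤ) = p.coeff n := by
  induction p using Polynomial.induction_on' with
  | add p r hp hr => simp [polyToL_add, hp, hr]
  | monomial m c =>
    rw [polyToL_monomial_s7, HahnSeries.coeff_single, coeff_monomial]
    grind

theorem polyToL_injective : Function.Injective (polyToL F) := by
  intro p r h
  ext n
  rw [← coeff_polyToL_neg, ← coeff_polyToL_neg, h]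

theorem polyToL_ne_zero {p : F[X]} (hp : p ≠ 0) : polyToL F p ≠ 0 := by
  rw [← polyToL_zero]
  exact polyToL_injective.ne hp

/-- Vanishing of all coefficients up to `N`, in terms of the order. -/
theorem LaurentSeries.forall_coeff_eq_zero_iff {R : Type*} [Zero R] (x : LaurentSeries R) (N : ℤ) :
    (∀ n ≤ N, x.coeff n = 0) ↔ x = 0 ∨ N < x.order := by
  constructor
  · intro h
    by_contra! hx
    exact hx.1 (HahnSeries.coeff_order_eq_zero.1 (h _ hx.2))
  · rintro (rfl | h) n hn
    · simp
    · exact HahnSeries.coeff_eq_zero_of_lt_order (hn.trans_lt h)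

theorem order_polyToL {p : F[X]} (hp : p ≠ 0) :
    (polyToL F p).order = -(p.natDegree : ℤ) := by
  apply le_antisymm
  · apply HahnSeries.order_le_of_coeff_ne_zero
    rw [coeff_polyToL_neg]
    simpa using hp
  · by_contra! h
    apply polyToL_ne_zero hp
    apply HahnSeries.coeff_order_eq_zero.1
    obtain ⟨m, hm⟩ : ∃ m : ℕ, (polyToL F p).order = -(m : ℤ) :=
      ⟨(-(polyToL F p).order).toNat, by omega⟩
    rw [hm, coeff_polyToL_neg]
    exact coeff_eq_zero_of_natDegree_lt (by omega)

theorem lnorm_polyToL {p : F[X]} (hp : p ≠ 0) :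
    lnorm F (polyToL F p) = (Fintype.card F : ℝ) ^ p.natDegree := by
  simp [lnorm, polyToL_ne_zero hp, order_polyToL hp]

theorem lnorm_lt_one_iff_s7 (x : LaurentSeries F) :
    lnorm F x < 1 ↔ ∀ n ≤ 0, x.coeff n = 0 := by
  rw [LaurentSeries.forall_coeff_eq_zero_iff]
  have hk : (1 : ℝ) < Fintype.card F := by exact_mod_cast Fintype.one_lt_card
  by_cases hx : x = 0
  · simp [lnorm, hx]
  · simp [lnorm, hx, -zpow_neg, zpow_lt_one_iff_right₀ hk]

theorem lnorm_lt_one_iff_coeff_polyToL_mul {g : F[X]} (hg : g ≠ 0) (x : LaurentSeries F) :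
    lnorm F x < 1 ↔ ∀ m : ℕ, g.natDegree ≤ m → (polyToL F g * x).coeff (-m : ℤ) = 0 := by
  have h : lnorm F x < 1 ↔ ∀ n ≤ -(g.natDegree : ℤ), (polyToL F g * x).coeff n = 0 := by
    rw [lnorm_lt_one_iff_s7, LaurentSeries.forall_coeff_eq_zero_iff,
      LaurentSeries.forall_coeff_eq_zero_iff]
    by_cases hx : x = 0
    · simp [hx]
    · simp [hx, polyToL_ne_zero hg, HahnSeries.order_mul (polyToL_ne_zero hg) hx,
        order_polyToL hg]
  rw [h]
  constructor
  · intro H m hm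
    exact H _ (by omega)
  · intro H n hn
    obtain ⟨m, rfl⟩ : ∃ m : ℕ, n = -(m : ℤ) := ⟨(-n).toNat, by omega⟩
    exact H m (by omega)

/-- Every Laurent series in `X⁻¹` has a polynomial part. -/
theorem exists_coeff_eq_coeff_neg {K : Type*} [Field K] (c : LaurentSeries K) :
    ∃ p : K[X], ∀ n : ℕ, p.coeff n = c.coeff (-n : ℤ) := by
  refine ⟨∑ i ∈ Finset.range ((-c.order).toNat + 1), monomial i (c.coeff (-i : ℤ)), fun n => ?_⟩
  simp only [finsetSum_coeff, coeff_monomial, Finset.sum_ite_eq', Finset.mem_range]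
  split_ifs with h
  · rfl
  · exact (HahnSeries.coeff_eq_zero_of_lt_order (by omega)).symm

/-- The solutions in the open unit ball of `g * x + c ∈ F[X]` are parametrised by the polynomials
of degree less than that of `g`. -/
theorem nonempty_equiv_degreeLT {g : F[X]} (hg : g ≠ 0) (c : LaurentSeries F) :
    Nonempty ({x : LaurentSeries F // lnorm F x < 1 ∧ ∃ p, polyToL F g * x + c = polyToL F p} ≃
      degreeLT F g.natDegree) := by
  obtain ⟨P, hP⟩ := exists_coeff_eq_coeff_neg c
  have hg' := polyToL_ne_zero hg
  have key (x : LaurentSeries F) (r : F[X]) (h : polyToL F g * x + c = polyToL F (r + P)) :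
      lnorm F x < 1 ↔ r ∈ degreeLT F g.natDegree := by
    rw [lnorm_lt_one_iff_coeff_polyToL_mul hg, mem_degreeLT, degree_lt_iff_coeff_zero,
      eq_sub_of_add_eq h]
    simp only [HahnSeries.coeff_sub, coeff_polyToL_neg, coeff_add, hP, add_sub_cancel_right]
  have hf (r : F[X]) :
      polyToL F g * ((polyToL F (r + P) - c) / polyToL F g) + c = polyToL F (r + P) := by
    rw [mul_div_cancel₀ _ hg', sub_add_cancel]
  refine ⟨(Equiv.ofBijective (fun r : degreeLT F g.natDegree =>
    ⟨(polyToL F (r + P) - c) / polyToL F g, (key _ _ (hf r)).2 r.2, _, hf r⟩) ⟨?_, ?_⟩).symm⟩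
  · intro r s h
    have h' := congrArg (fun x => polyToL F g * x + c) (Subtype.ext_iff.1 h)
    simp only [hf] at h'
    exact Subtype.ext (add_right_cancel (polyToL_injective h'))
  · rintro ⟨x, hx, p, hp⟩
    rw [← sub_add_cancel p P] at hp
    refine ⟨⟨p - P, (key _ _ hp).1 hx⟩, Subtype.ext ?_⟩
    rw [div_eq_iff hg', ← hp]
    ring

theorem card_degreeLT (n : ℕ) : Nat.card (degreeLT F n) = Fintype.card F ^ n := by
  rw [Nat.card_congr (degreeLTEquiv F n).toEquiv]
  simp

theorem card_solutions_triangular {g d : F[X]} (hg : g ≠ 0) (hd : d ≠ 0) (b : F[X]) :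
    Nat.card {a : Fin 2 → LaurentSeries F // (∀ i, lnorm F (a i) < 1) ∧
      (∃ p, polyToL F g * a 0 + polyToL F b * a 1 = polyToL F p) ∧
      (∃ p, polyToL F d * a 1 = polyToL F p)} = Fintype.card F ^ (g * d).natDegree := by
  let e : {a : Fin 2 → LaurentSeries F // (∀ i, lnorm F (a i) < 1) ∧
      (∃ p, polyToL F g * a 0 + polyToL F b * a 1 = polyToL F p) ∧
      (∃ p, polyToL F d * a 1 = polyToL F p)} ≃
      Σ y : {y : LaurentSeries F // lnorm F y < 1 ∧ ∃ p, polyToL F d * y + 0 = polyToL F p},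
        {x : LaurentSeries F // lnorm F x < 1 ∧
          ∃ p, polyToL F g * x + polyToL F b * y = polyToL F p} :=
    { toFun := fun a => ⟨⟨a.1 1, a.2.1 1, by simpa using a.2.2.2⟩, ⟨a.1 0, a.2.1 0, a.2.2.1⟩⟩
      invFun := fun z => ⟨![z.2.1, z.1.1], by simpa [Fin.forall_fin_two] using ⟨z.2.2.1, z.1.2.1⟩,
        by simpa using z.2.2.2, by simpa using z.1.2.2⟩
      left_inv := fun a => Subtype.ext (by ext i; fin_cases i <;> rfl)
      right_inv := fun z => rfl }
  have e₁ := e.trans (Equiv.sigmaCongrRight fun y =>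
    (nonempty_equiv_degreeLT hg (polyToL F b * y.1)).some)
  rw [Nat.card_congr (e₁.trans (Equiv.sigmaEquivProd _ _)), Nat.card_prod,
    Nat.card_congr (nonempty_equiv_degreeLT hd 0).some, card_degreeLT, card_degreeLT,
    natDegree_mul hg hd, pow_add, mul_comm]

theorem det_ne_zero_of_linearIndependent {q q' : Fin 2 → F[X]}
    (hind : LinearIndependent (LaurentSeries F)
      ![fun i => polyToL F (q i), fun i => polyToL F (q' i)]) :
    q 0 * q' 1 - q 1 * q' 0 ≠ 0 := by
  intro h
  have hdet : polyToL F (q 0) * polyToL F (q' 1) = polyToL F (q 1) * polyToL F (q' 0) := by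
    rw [← polyToL_mul, ← polyToL_mul, sub_eq_zero.1 h]
  rw [LinearIndependent.pair_iff] at hind
  have h1 := hind (polyToL F (q' 1)) (-polyToL F (q 1)) (by
    ext1 i
    fin_cases i
    · simp
      linear_combination hdet
    · simp
      ring)
  have h0 := hind (polyToL F (q' 0)) (-polyToL F (q 0)) (by
    ext1 i
    fin_cases i
    · simp
      ring
    · simp
      linear_combination -hdet)
  have h2 := hind 1 0 (by
    ext1 i
    fin_cases i
    · simpa using h0.2
    · simpa using h1.2)
  exact one_ne_zero h2.1

/-- Bézout row reduction of the first column `(x, y)`. -/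
theorem exists_bezout {K : Type*} [Field K] {x y : K[X]} (h : x ≠ 0 ∨ y ≠ 0) :
    ∃ g s t u v : K[X], x = g * s ∧ y = g * t ∧ u * s + v * t = 1 := by
  obtain ⟨s, hs⟩ := EuclideanDomain.gcd_dvd_left x y
  obtain ⟨t, ht⟩ := EuclideanDomain.gcd_dvd_right x y
  have hab := EuclideanDomain.gcd_eq_gcd_ab x y
  have hg : EuclideanDomain.gcd x y ≠ 0 := by
    rw [Ne, EuclideanDomain.gcd_eq_zero_iff]
    tauto
  refine ⟨_, s, t, EuclideanDomain.gcdA x y, EuclideanDomain.gcdB x y, hs, ht,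
    mul_left_cancel₀ hg ?_⟩
  linear_combination -hab - EuclideanDomain.gcdA x y * hs - EuclideanDomain.gcdB x y * ht

end

/-- Let `q = (q₁, q₂)` and `q' = (q₁', q₂')` in `F[X]²` be linearly
independent over `L`.  The number of `A = (a₁, a₂) ∈ L²` with
`max(‖a₁‖, ‖a₂‖) < 1` such that `q₁ a₁ + q₂ a₂ ∈ F[X]` and
`q₁' a₁ + q₂' a₂ ∈ F[X]` equals `‖q₁ q₂' - q₂ q₁'‖`, the absolute value of the
determinant of the matrix with rows `q` and `q'`. -/
theorem card_intersections_eq_det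
    {F : Type*} [Field F] [Fintype F]
    (q q' : Fin 2 → Polynomial F)
    (hind : LinearIndependent (LaurentSeries F)
      ![fun i => polyToL F (q i), fun i => polyToL F (q' i)]) :
    (Nat.card {a : Fin 2 → LaurentSeries F //
        (∀ i, lnorm F (a i) < 1) ∧
        (∃ p : Polynomial F,
          polyToL F (q 0) * a 0 + polyToL F (q 1) * a 1 = polyToL F p) ∧
        (∃ p' : Polynomial F,
          polyToL F (q' 0) * a 0 + polyToL F (q' 1) * a 1 = polyToL F p')} : ℝ) =
      lnorm F (polyToL F (q 0 * q' 1 - q 1 * q' 0)) := by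
  have hdet := det_ne_zero_of_linearIndependent hind
  have hcol : q 0 ≠ 0 ∨ q' 0 ≠ 0 := by
    by_contra! h
    simp [h.1, h.2] at hdet
  obtain ⟨g, s, t, u, v, hs, ht, huv⟩ := exists_bezout hcol
  have hgd : q 0 * q' 1 - q 1 * q' 0 = g * (s * q' 1 - t * q 1) := by
    rw [hs, ht]
    ring
  rw [lnorm_polyToL hdet, hgd]
  rw [hgd] at hdet
  have huvL : polyToL F u * polyToL F s + polyToL F v * polyToL F t = 1 := by
    rw [← polyToL_mul, ← polyToL_mul, ← polyToL_add, huv, polyToL_one]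
  rw [← Nat.cast_pow, ← card_solutions_triangular (left_ne_zero_of_mul hdet)
    (right_ne_zero_of_mul hdet) (u * q 1 + v * q' 1)]
  congr 1
  refine Nat.card_congr (Equiv.subtypeEquivRight fun a => and_congr_right fun _ => ?_)
  rw [hs, ht]
  simp only [polyToL_add, polyToL_sub, polyToL_mul]
  constructor
  · rintro ⟨⟨p, hp⟩, p', hp'⟩
    refine ⟨⟨u * p + v * p', ?_⟩, s * p' - t * p, ?_⟩
    · simp only [polyToL_add, polyToL_mul]
      linear_combination polyToL F u * hp + polyToL F v * hp' - polyToL F g * a 0 * huvL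
    · simp only [polyToL_sub, polyToL_mul]
      linear_combination polyToL F s * hp' - polyToL F t * hp
  · rintro ⟨⟨p, hp⟩, p', hp'⟩
    refine ⟨⟨s * p - v * p', ?_⟩, t * p + u * p', ?_⟩
    · simp only [polyToL_sub, polyToL_mul]
      linear_combination polyToL F s * hp - polyToL F v * hp' - polyToL F (q 1) * a 1 * huvL
    · simp only [polyToL_add, polyToL_mul]
      linear_combination polyToL F t * hp + polyToL F u * hp' - polyToL F (q' 1) * a 1 * huvL
end
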